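/- Let Z be a generator process on I = [0,1]^k, K an admissible kernel, grids 𝒢_n with mesh ε_n → 0, bandwidths h_n → 0 with ε_n/h_n → ∞, kernel weights g_{i,n} and Ẑ_{t,n} := max_{1≤i≤d(n)} g_{i,n}(t)·Z_{s_{i,n}}. Then ∫_{[0,1]^k} E[|Z_t − Ẑ_{t,n}|] dt → 0 as n → ∞. -/

import Mathlib

open MeasureTheory ProbabilityTheory Filter Topology

/-- On a finite-dimensional coordinate space, a norm dominates a multiple of the sup norm. -/
lemma exists_pos_mul_norm_le {k : ℕ} {N : (Fin k → ℝ) → ℝ}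
    (hN0 : ∀ x, 0 ≤ N x) (hNeq0 : ∀ x, N x = 0 ↔ x = 0)
    (hNadd : ∀ x y, N (x + y) ≤ N x + N y) (hNsmul : ∀ (c : ℝ) x, N (c • x) = |c| * N x) :
    ∃ c > 0, ∀ x, c * ‖x‖ ≤ N x := by
  have hconv : ConvexOn ℝ Set.univ N := by
    refine ⟨convex_univ, fun x _ y _ a b ha hb _ => ?_⟩
    refine (hNadd _ _).trans_eq ?_
    rw [hNsmul, hNsmul, abs_of_nonneg ha, abs_of_nonneg hb, smul_eq_mul, smul_eq_mul]
  have hcont : Continuous N := hconv.locallyLipschitz.continuous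
  rcases (Metric.sphere (0 : Fin k → ℝ) 1).eq_empty_or_nonempty with hS | hS
  · refine ⟨1, one_pos, fun x => ?_⟩
    by_cases hx : x = 0
    · simpa [hx] using hN0 0
    · have hmem : ‖x‖⁻¹ • x ∈ Metric.sphere (0 : Fin k → ℝ) 1 := by
        simp [norm_smul, norm_ne_zero_iff.2 hx]
      simp [hS] at hmem
  · obtain ⟨y, hy, hmin⟩ := (isCompact_sphere (0 : Fin k → ℝ) 1).exists_isMinOn hS
      hcont.continuousOn
    have hy1 : ‖y‖ = 1 := by simpa using hy
    have hy0 : y ≠ 0 := by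
      rintro rfl
      simp at hy1
    refine ⟨N y, lt_of_le_of_ne (hN0 y) (fun he => hy0 ((hNeq0 y).1 he.symm)), fun x => ?_⟩
    by_cases hx : x = 0
    · simpa [hx] using hN0 0
    · have hxn : 0 < ‖x‖ := norm_pos_iff.2 hx
      have hmem : ‖x‖⁻¹ • x ∈ Metric.sphere (0 : Fin k → ℝ) 1 := by
        simp [norm_smul, hxn.ne']
      have hle : N y ≤ N (‖x‖⁻¹ • x) := hmin hmem
      rw [hNsmul, abs_of_pos (inv_pos.2 hxn)] at hle
      calc N y * ‖x‖ ≤ (‖x‖⁻¹ * N x) * ‖x‖ := by gcongr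
        _ = N x := by field_simp

/-- The largest of the values of `f` at the grid points, weighted by a kernel normalised at the
nearest grid point, approximates `f (t n)` as mesh and bandwidth tend to zero. -/
lemma tendsto_iSup_kernel_sub {k : ℕ} {N : (Fin k → ℝ) → ℝ}
    (hN0 : ∀ x, 0 ≤ N x) {c : ℝ} (hc : 0 < c) (hcN : ∀ x, c * ‖x‖ ≤ N x)
    {K : ℝ → ℝ} (hKanti : StrictAntiOn K (Set.Ici 0))
    (hKpos : ∀ x ∈ Set.Ici (0 : ℝ), 0 < K x)
    (hKratio : ∀ a b : ℝ, 0 ≤ b → b < a →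
      Tendsto (fun x => K (a * x) / K (b * x)) atTop (𝓝 0))
    {d : ℕ → ℕ} {s : (n : ℕ) → Fin (d n) → (Fin k → ℝ)}
    (hsI : ∀ n i, s n i ∈ Set.Icc (0 : Fin k → ℝ) 1)
    {ε h : ℕ → ℝ} (hε : Tendsto ε atTop (𝓝 0))
    (hhpos : ∀ n, 0 < h n) (hh : Tendsto h atTop (𝓝 0))
    {t : ℕ → Fin k → ℝ} (ht : ∀ n, t n ∈ Set.Icc (0 : Fin k → ℝ) 1)
    {p : (n : ℕ) → Fin (d n)} (hp : ∀ n, N (t n - s n (p n)) ≤ ε n)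
    {f : (Fin k → ℝ) → ℝ} (hf : ContinuousOn f (Set.Icc (0 : Fin k → ℝ) 1))
    (hf0 : ∀ x ∈ Set.Icc (0 : Fin k → ℝ) 1, 0 ≤ f x)
    (hmin : ∀ n j, N (t n - s n (p n)) ≤ N (t n - s n j)) :
    Tendsto (fun n => (⨆ j, K (N (t n - s n j) / h n) / K (N (t n - s n (p n)) / h n)
      * f (s n j)) - f (t n)) atTop (𝓝 0) := by
  have hucont := isCompact_Icc.uniformContinuousOn_of_continuous hf
  obtain ⟨B, hB⟩ := isCompact_Icc.bddAbove_image hf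
  have hB' : ∀ x ∈ Set.Icc (0 : Fin k → ℝ) 1, f x ≤ B := fun x hx =>
    hB (Set.mem_image_of_mem f hx)
  have hnn : ∀ n x, 0 ≤ N x / h n := fun n x => div_nonneg (hN0 x) (hhpos n).le
  have hB0 : 0 ≤ B := (hf0 _ (ht 0)).trans (hB' _ (ht 0))
  rw [Metric.tendsto_atTop']
  intro η hη
  obtain ⟨δ', hδ', huc⟩ := Metric.uniformContinuousOn_iff.1 hucont (η / 2) (by positivity)
  set δ := c * δ'
  have hδ : 0 < δ := by positivity
  have hclose : ∀ x ∈ Set.Icc (0 : Fin k → ℝ) 1, ∀ y ∈ Set.Icc (0 : Fin k → ℝ) 1,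
      N (x - y) < δ → |f x - f y| < η / 2 := by
    intro x hx y hy hxy
    refine huc x hx y hy ?_
    rw [dist_eq_norm]
    exact lt_of_mul_lt_mul_left ((hcN _).trans_lt hxy) hc.le
  have hinv : Tendsto (fun n => (h n)⁻¹) atTop atTop :=
    (tendsto_inv_nhdsGT_zero (𝕜 := ℝ)).comp
      (tendsto_nhdsWithin_iff.2 ⟨hh, Eventually.of_forall hhpos⟩)
  have hfar : Tendsto (fun n => K (δ * (h n)⁻¹) / K (δ / 2 * (h n)⁻¹) * B) atTop (𝓝 0) := by
    simpa using ((hKratio δ (δ / 2) (by positivity) (by linarith)).comp hinv).mul_const B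
  have hev : ∀ᶠ n in atTop, ε n < δ / 2 ∧
      K (δ * (h n)⁻¹) / K (δ / 2 * (h n)⁻¹) * B < η / 2 :=
    (hε.eventually_lt_const (by positivity)).and (hfar.eventually_lt_const (by positivity))
  obtain ⟨n₀, hn₀⟩ := eventually_atTop.1 hev
  refine ⟨n₀, fun n hn => ?_⟩
  obtain ⟨hεn, hfarn⟩ := hn₀ n hn.le
  have hKp : 0 < K (N (t n - s n (p n)) / h n) := hKpos _ (hnn _ _)
  have hpδ : N (t n - s n (p n)) < δ / 2 := (hp n).trans_lt hεn
  have hupper : (⨆ j, K (N (t n - s n j) / h n) / K (N (t n - s n (p n)) / h n)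
      * f (s n j)) ≤ f (t n) + η / 2 := by
    have : Nonempty (Fin (d n)) := ⟨p n⟩
    refine ciSup_le fun j => ?_
    rcases lt_or_ge (N (t n - s n j)) δ with hj | hj
    · have h1 : K (N (t n - s n j) / h n) / K (N (t n - s n (p n)) / h n) ≤ 1 := by
        rw [div_le_one hKp]
        exact hKanti.antitoneOn (hnn _ _) (hnn _ _)
          (div_le_div_of_nonneg_right (hmin n j) (hhpos n).le)
      have h2 := (abs_lt.1 (hclose _ (ht n) _ (hsI n j) hj)).1
      have h3 := mul_le_of_le_one_left (hf0 _ (hsI n j)) h1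
      linarith
    · have hi : 0 < (h n)⁻¹ := inv_pos.2 (hhpos n)
      have h1 : K (N (t n - s n j) / h n) ≤ K (δ * (h n)⁻¹) := by
        refine hKanti.antitoneOn (Set.mem_Ici.2 (by positivity)) (hnn _ _) ?_
        rw [div_eq_mul_inv]
        gcongr
      have h2 : K (δ / 2 * (h n)⁻¹) ≤ K (N (t n - s n (p n)) / h n) := by
        refine hKanti.antitoneOn (hnn _ _) (Set.mem_Ici.2 (by positivity)) ?_
        rw [div_eq_mul_inv]
        gcongr
      have h3 : 0 < K (δ / 2 * (h n)⁻¹) := hKpos _ (Set.mem_Ici.2 (by positivity))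
      have h4 : 0 < K (δ * (h n)⁻¹) := hKpos _ (Set.mem_Ici.2 (by positivity))
      have h5 : K (N (t n - s n j) / h n) / K (N (t n - s n (p n)) / h n) * f (s n j)
          ≤ K (δ * (h n)⁻¹) / K (δ / 2 * (h n)⁻¹) * B := by
        refine mul_le_mul (div_le_div₀ h4.le h1 h3 h2) (hB' _ (hsI n j)) (hf0 _ (hsI n j))
          (by positivity)
      have := hf0 _ (ht n)
      linarith
  have hlower : f (s n (p n)) ≤ ⨆ j, K (N (t n - s n j) / h n) /
      K (N (t n - s n (p n)) / h n) * f (s n j) := by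
    refine le_trans ?_ (le_ciSup (Set.finite_range _).bddAbove (p n))
    rw [div_self hKp.ne', one_mul]
  have hp2 := (abs_lt.1 (hclose _ (ht n) _ (hsI n (p n)) (by linarith))).2
  rw [Real.dist_eq, sub_zero, abs_lt]
  constructor <;> linarith

/-- A process continuous on the unit cube that is a.s. nonnegative at each point is a.s. nonnegative
on the whole cube. -/
lemma ae_forall_nonneg_of_forall_ae {Ω : Type*} [MeasurableSpace Ω] {μ : Measure Ω} {k : ℕ}
    {Z : Ω → (Fin k → ℝ) → ℝ}
    (hZcont : ∀ ω, ContinuousOn (Z ω) (Set.Icc (0 : Fin k → ℝ) 1))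
    (hZpos : ∀ t ∈ Set.Icc (0 : Fin k → ℝ) 1, ∀ᵐ ω ∂μ, 0 ≤ Z ω t) :
    ∀ᵐ ω ∂μ, ∀ t ∈ Set.Icc (0 : Fin k → ℝ) 1, 0 ≤ Z ω t := by
  obtain ⟨D, hDc, hDd⟩ :=
    TopologicalSpace.exists_countable_dense (Set.Icc (0 : Fin k → ℝ) 1)
  have hD : ∀ᵐ ω ∂μ, ∀ x ∈ D, 0 ≤ Z ω x.1 :=
    (ae_ball_iff hDc).2 fun x _ => hZpos x.1 x.2
  filter_upwards [hD] with ω hω t ht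
  have hcl : IsClosed {x : Set.Icc (0 : Fin k → ℝ) 1 | 0 ≤ Z ω x.1} :=
    isClosed_le continuous_const (continuousOn_iff_continuous_domRestrict.1 (hZcont ω))
  exact hcl.closure_subset_iff.2 hω (hDd ⟨t, ht⟩)

/-- If `F n (t n)` tends to zero along every sequence `t` in a nonempty set `S`, then `F` tends to
zero uniformly on `S`. -/
lemma eventually_forall_le_of_forall_seq_tendsto {α : Type*} {S : Set α} (hS : S.Nonempty)
    {F : ℕ → α → ℝ}
    (hF : ∀ t : ℕ → α, (∀ n, t n ∈ S) → Tendsto (fun n => F n (t n)) atTop (𝓝 0))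
    {η : ℝ} (hη : 0 < η) : ∀ᶠ n in atTop, ∀ x ∈ S, F n x ≤ η := by
  have hex : ∀ n, ∃ y ∈ S, F n y ≤ η → ∀ x ∈ S, F n x ≤ η := by
    intro n
    by_cases hn : ∀ x ∈ S, F n x ≤ η
    · obtain ⟨y, hy⟩ := hS
      exact ⟨y, hy, fun _ => hn⟩
    · push Not at hn
      obtain ⟨y, hy, hlt⟩ := hn
      exact ⟨y, hy, fun hle => absurd hle hlt.not_ge⟩
  choose t ht hbound using hex
  filter_upwards [(hF t ht).eventually_le_const hη] with n hn
  exact hbound n hn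

/-- Let `Z` be a generator process on `I = [0,1]^k`, `K` an admissible
kernel, grids `𝒢_n` with mesh `ε_n → 0`, bandwidths `h_n → 0` with `ε_n / h_n → ∞`,
kernel weights `g_{i,n}` and `Ẑ_{t,n} = max_i g_{i,n}(t) Z_{s_{i,n}}`.  Then
`∫_{[0,1]^k} E |Z_t - Ẑ_{t,n}| dt → 0` as `n → ∞`. -/
theorem kernel_generator_integrated_L1_convergence
    {Ω : Type*} [MeasureSpace Ω] [IsProbabilityMeasure (ℙ : Measure Ω)]
    {k : ℕ} (hk : 1 ≤ k)
    (N : (Fin k → ℝ) → ℝ)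
    (hN0 : ∀ x, 0 ≤ N x)
    (hNeq0 : ∀ x, N x = 0 ↔ x = 0)
    (hNadd : ∀ x y, N (x + y) ≤ N x + N y)
    (hNsmul : ∀ (c : ℝ) x, N (c • x) = |c| * N x)
    (Z : Ω → (Fin k → ℝ) → ℝ)
    (hZcont : ∀ ω, ContinuousOn (Z ω) (Set.Icc (0 : Fin k → ℝ) 1))
    (hZmeas : ∀ t ∈ Set.Icc (0 : Fin k → ℝ) 1, Measurable fun ω => Z ω t)
    (hZpos : ∀ t ∈ Set.Icc (0 : Fin k → ℝ) 1, ∀ᵐ ω ∂ℙ, 0 ≤ Z ω t)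
    (hZone : ∀ t ∈ Set.Icc (0 : Fin k → ℝ) 1, ∫ ω, Z ω t = 1)
    (hZsup : Integrable (fun ω => ⨆ t : Set.Icc (0 : Fin k → ℝ) 1, Z ω t.1))
    (K : ℝ → ℝ)
    (hKcont : ContinuousOn K (Set.Ici 0))
    (hKanti : StrictAntiOn K (Set.Ici 0))
    (hKzero : K 0 = 1)
    (hKrange : ∀ x ∈ Set.Ici (0 : ℝ), K x ∈ Set.Ioc (0 : ℝ) 1)
    (hKratio : ∀ a b : ℝ, 0 ≤ b → b < a →
      Tendsto (fun x => K (a * x) / K (b * x)) atTop (𝓝 0))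
    (d : ℕ → ℕ) (hd : ∀ n, 0 < d n)
    (s : (n : ℕ) → Fin (d n) → (Fin k → ℝ))
    (hsI : ∀ n i, s n i ∈ Set.Icc (0 : Fin k → ℝ) 1)
    (hsinj : ∀ n, Function.Injective (s n))
    (ε : ℕ → ℝ)
    (hmesh : ∀ n, ∀ t ∈ Set.Icc (0 : Fin k → ℝ) 1, ∃ i, N (t - s n i) ≤ ε n)
    (hε : Tendsto ε atTop (𝓝 0))
    (h : ℕ → ℝ) (hhpos : ∀ n, 0 < h n) (hh : Tendsto h atTop (𝓝 0))
    (hratio : Tendsto (fun n => ε n / h n) atTop atTop)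
    (g : (n : ℕ) → Fin (d n) → (Fin k → ℝ) → ℝ)
    (hgdef : ∀ n i t, g n i t
      = K (N (t - s n i) / h n) / ∫ ω, ⨆ j, K (N (t - s n j) / h n) * Z ω (s n j)) :
    Tendsto (fun n => ∫ t in Set.Icc (0 : Fin k → ℝ) 1,
        ∫ ω, |Z ω t - ⨆ i, g n i t * Z ω (s n i)|) atTop (𝓝 0) := by
  have hKpos : ∀ x ∈ Set.Ici (0 : ℝ), 0 < K x := fun x hx => (hKrange x hx).1
  obtain ⟨c, hc, hcN⟩ := exists_pos_mul_norm_le hN0 hNeq0 hNadd hNsmul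
  have hnonneg := ae_forall_nonneg_of_forall_ae hZcont hZpos
  have hseq : ∀ t : ℕ → Fin k → ℝ, (∀ n, t n ∈ Set.Icc (0 : Fin k → ℝ) 1) →
      Tendsto (fun n => ∫ ω, |Z ω (t n) - ⨆ i, g n i (t n) * Z ω (s n i)|) atTop (𝓝 0) := by
    intro t ht
    have hexmin : ∀ n, ∃ p, ∀ j, N (t n - s n p) ≤ N (t n - s n j) := fun n =>
      have : Nonempty (Fin (d n)) := ⟨⟨0, hd n⟩⟩
      Finite.exists_min fun j => N (t n - s n j)
    choose p hmin using hexmin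
    have hpε : ∀ n, N (t n - s n (p n)) ≤ ε n := fun n =>
      let ⟨i, hi⟩ := hmesh n (t n) (ht n)
      (hmin n i).trans hi
    have hnn : ∀ n x, 0 ≤ N x / h n := fun n x => div_nonneg (hN0 x) (hhpos n).le
    set κ : ℕ → ℝ := fun n => K (N (t n - s n (p n)) / h n)
    have hκpos : ∀ n, 0 < κ n := fun n => hKpos _ (hnn _ _)
    set M : ℕ → Ω → ℝ := fun n ω => ⨆ j, K (N (t n - s n j) / h n) / κ n * Z ω (s n j) with hM
    set S : Ω → ℝ := fun ω => ⨆ t : Set.Icc (0 : Fin k → ℝ) 1, Z ω t.1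
    have hleS : ∀ ω, ∀ x ∈ Set.Icc (0 : Fin k → ℝ) 1, Z ω x ≤ S ω := by
      intro ω x hx
      have hbdd : BddAbove (Set.range fun t : Set.Icc (0 : Fin k → ℝ) 1 => Z ω t.1) := by
        have := isCompact_Icc.bddAbove_image (hZcont ω)
        rwa [Set.image_eq_range] at this
      exact le_ciSup hbdd ⟨x, hx⟩
    have hMmeas : ∀ n, Measurable (M n) := fun n =>
      Measurable.iSup fun j => (hZmeas _ (hsI n j)).const_mul _
    have hMnonneg : ∀ᵐ ω, ∀ n, 0 ≤ M n ω := by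
      filter_upwards [hnonneg] with ω hω n
      exact Real.iSup_nonneg fun j =>
        mul_nonneg (div_nonneg (hKpos _ (hnn _ _)).le (hκpos n).le) (hω _ (hsI n j))
    have hMle : ∀ᵐ ω, ∀ n, M n ω ≤ S ω := by
      filter_upwards [hnonneg] with ω hω n
      have : Nonempty (Fin (d n)) := ⟨p n⟩
      refine ciSup_le fun j => ?_
      refine (mul_le_of_le_one_left (hω _ (hsI n j)) ?_).trans (hleS ω _ (hsI n j))
      rw [div_le_one (hκpos n)]
      exact hKanti.antitoneOn (hnn _ _) (hnn _ _)
        (div_le_div_of_nonneg_right (hmin n j) (hhpos n).le)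
    have hMint : ∀ n, Integrable (M n) := fun n =>
      hZsup.mono' (hMmeas n).aestronglyMeasurable (by
        filter_upwards [hMnonneg, hMle] with ω h0 h1
        rw [Real.norm_of_nonneg (h0 n)]
        exact h1 n)
    have hZint : ∀ x ∈ Set.Icc (0 : Fin k → ℝ) 1, Integrable fun ω => Z ω x := fun x hx =>
      hZsup.mono' (hZmeas x hx).aestronglyMeasurable (by
        filter_upwards [hnonneg] with ω hω
        rw [Real.norm_of_nonneg (hω x hx)]
        exact hleS ω x hx)
    have hptw : ∀ᵐ ω, Tendsto (fun n => M n ω - Z ω (t n)) atTop (𝓝 0) := by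
      filter_upwards [hnonneg] with ω hω
      exact tendsto_iSup_kernel_sub hN0 hc hcN hKanti hKpos hKratio hsI hε hhpos hh ht hpε
        (hZcont ω) hω hmin
    have hmean : Tendsto (fun n => ∫ ω, M n ω) atTop (𝓝 1) := by
      have hlim : Tendsto (fun n => ∫ ω, (M n ω - Z ω (t n))) atTop (𝓝 (∫ _ : Ω, (0 : ℝ))) := by
        refine tendsto_integral_filter_of_dominated_convergence S
          (Eventually.of_forall fun n =>
            ((hMmeas n).sub (hZmeas _ (ht n))).aestronglyMeasurable)
          (Eventually.of_forall fun n => ?_) hZsup hptw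
        filter_upwards [hnonneg, hMnonneg, hMle] with ω hω h0 h1
        have := hω _ (ht n)
        have := hleS ω _ (ht n)
        have := h0 n
        have := h1 n
        rw [Real.norm_eq_abs, abs_le]
        constructor <;> linarith
      have hadd := hlim.add_const 1
      simp only [integral_zero, zero_add] at hadd
      refine hadd.congr fun n => ?_
      rw [integral_sub (hMint n) (hZint _ (ht n)), hZone _ (ht n)]
      ring
    have hinv : Tendsto (fun n => (∫ ω, M n ω)⁻¹) atTop (𝓝 1) := by
      simpa using hmean.inv₀ one_ne_zero
    have hZhat : ∀ᶠ n in atTop, ∀ ω,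
        (⨆ i, g n i (t n) * Z ω (s n i)) = (∫ ω, M n ω)⁻¹ * M n ω := by
      filter_upwards [hmean.eventually_const_lt one_pos] with n hn ω
      have hnum : ∀ ω, (⨆ j, K (N (t n - s n j) / h n) * Z ω (s n j)) = κ n * M n ω := by
        intro ω
        rw [hM, Real.mul_iSup_of_nonneg (hκpos n).le]
        refine iSup_congr fun j => ?_
        have := (hκpos n).ne'
        field_simp
      rw [show M n ω = ⨆ j, K (N (t n - s n j) / h n) / κ n * Z ω (s n j) from rfl,
        Real.mul_iSup_of_nonneg (inv_nonneg.2 hn.le)]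
      refine iSup_congr fun j => ?_
      rw [hgdef, integral_congr_ae (Eventually.of_forall hnum), integral_const_mul,
        div_mul_eq_div_div]
      ring
    have hlim : Tendsto (fun n => ∫ ω, |Z ω (t n) - (∫ ω, M n ω)⁻¹ * M n ω|) atTop
        (𝓝 (∫ _ : Ω, (0 : ℝ))) := by
      refine tendsto_integral_filter_of_dominated_convergence (fun ω => 2 * S ω)
        (Eventually.of_forall fun n =>
          ((hZmeas _ (ht n)).sub ((hMmeas n).const_mul _)).abs.aestronglyMeasurable)
        ?_ (hZsup.const_mul 2) ?_
      · filter_upwards [hinv.eventually_const_lt one_pos,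
          hinv.eventually_lt_const one_lt_two] with n hn0 hn2
        filter_upwards [hnonneg, hMnonneg, hMle] with ω hω h0 h1
        have hz0 := hω _ (ht n)
        have hzS := hleS ω _ (ht n)
        have hm0 : 0 ≤ (∫ ω, M n ω)⁻¹ * M n ω := mul_nonneg hn0.le (h0 n)
        have hmS : (∫ ω, M n ω)⁻¹ * M n ω ≤ 2 * S ω :=
          mul_le_mul hn2.le (h1 n) (h0 n) zero_le_two
        rw [Real.norm_eq_abs, abs_abs, abs_le]
        constructor <;> linarith
      · filter_upwards [hptw, hMnonneg, hMle] with ω hω h0 h1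
        have hsmall : Tendsto (fun n => ((∫ ω, M n ω)⁻¹ - 1) * M n ω) atTop (𝓝 0) := by
          have hb : Tendsto (fun n => |(∫ ω, M n ω)⁻¹ - 1| * S ω) atTop (𝓝 0) := by
            simpa using ((hinv.sub_const 1).abs).mul_const (S ω)
          refine squeeze_zero_norm (fun n => ?_) hb
          rw [norm_mul, Real.norm_eq_abs, Real.norm_of_nonneg (h0 n)]
          exact mul_le_mul_of_nonneg_left (h1 n) (abs_nonneg _)
        have habs := ((hω.add hsmall).neg).abs
        simp only [add_zero, neg_zero, abs_zero] at habs
        refine habs.congr fun n => ?_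
        congr 1
        ring
    rw [integral_zero] at hlim
    refine hlim.congr' ?_
    filter_upwards [hZhat] with n hn
    simp only [hn]
  have hvol : volume (Set.Icc (0 : Fin k → ℝ) 1) < ⊤ := isCompact_Icc.measure_lt_top
  have hvol1 : volume.real (Set.Icc (0 : Fin k → ℝ) 1) = 1 := by
    simp [Measure.real, Real.volume_Icc_pi]
  rw [Metric.tendsto_atTop']
  intro η hη
  obtain ⟨n₀, hn₀⟩ := eventually_atTop.1 (eventually_forall_le_of_forall_seq_tendsto
    (F := fun n t => ∫ ω, |Z ω t - ⨆ i, g n i t * Z ω (s n i)|)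
    (Set.nonempty_Icc.2 zero_le_one) hseq (half_pos hη))
  refine ⟨n₀, fun n hn => ?_⟩
  have hle := norm_setIntegral_le_of_norm_le_const (μ := volume) hvol (C := η / 2)
    (f := fun t => ∫ ω, |Z ω t - ⨆ i, g n i t * Z ω (s n i)|) fun t ht => by
      rw [Real.norm_of_nonneg (integral_nonneg fun ω => abs_nonneg _)]
      exact hn₀ n hn.le t ht
  rw [hvol1, mul_one] at hle
  rw [dist_zero_right]
  exact hle.trans_lt (half_lt_self hη)
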